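/- Let f, g, h : ℝ → ℝ be infinitely differentiable and set X = f(B), Y = g(B), Z = h(B). Then for every T > 0, sup_{0 ≤ t ≤ T} | ∑_{j=1}^{⌊nt⌋} (X(t_j) − X(t_{j−1}))(Y(t_j) − Y(t_{j−1}))(Z(t_j) − Z(t_{j−1})) − ∑_{j=1}^{⌊nt⌋} (f' g' h')(β_{j,n}) (ΔB_{j,n})³ | → 0 in probability as n → ∞. (The weak triple covariation of X, Y, Z equals ∫ (f'g'h')(B) d⟦B⟧.) -/

import Mathlib

open MeasureTheory ProbabilityTheory Filter Topology

noncomputable section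

/-- `B` is a fractional Brownian motion with Hurst parameter `1/6`: a centered Gaussian
process with continuous sample paths and covariance
`E[B s * B t] = (t^(1/3) + s^(1/3) - |t - s|^(1/3)) / 2` for `s, t ≥ 0`. -/
def IsFBM16 {Ω : Type*} [MeasureSpace Ω] (B : ℝ → Ω → ℝ) : Prop :=
  (∀ t : ℝ, Measurable (B t)) ∧
  (∀ ω : Ω, Continuous fun t : ℝ => B t ω) ∧
  (∀ (m : ℕ) (t : Fin m → ℝ) (c : Fin m → ℝ), (∀ i, 0 ≤ t i) →
    ∃ v : NNReal,
      Measure.map (fun ω => ∑ i, c i * B (t i) ω) (volume : Measure Ω) = gaussianReal 0 v) ∧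
  (∀ s t : ℝ, 0 ≤ s → 0 ≤ t →
    ∫ ω, B s ω * B t ω =
      (t ^ ((1 : ℝ) / 3) + s ^ ((1 : ℝ) / 3) - |t - s| ^ ((1 : ℝ) / 3)) / 2)

section Taylor

lemma abs_le_of_abs_deriv_le_pow {r r' : ℝ → ℝ} {C L : ℝ} {k : ℕ}
    (hr : ∀ x, HasDerivAt r (r' x) x) (h0 : r 0 = 0)
    (hC : ∀ x, |x| ≤ L → |r' x| ≤ C * |x| ^ k) {x : ℝ} (hx : |x| ≤ L) :
    |r x| ≤ C * |x| ^ (k + 1) := by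
  have hCx : 0 ≤ C * |x| ^ k := (abs_nonneg _).trans (hC x hx)
  have hbound : ∀ y ∈ Set.uIcc 0 x, ‖r' y‖ ≤ C * |x| ^ k := by
    intro y hy
    have hyx : |y| ≤ |x| := by
      simpa using Set.abs_sub_left_of_mem_uIcc hy
    rcases eq_or_ne x 0 with rfl | hx0
    · obtain rfl : y = 0 := by simpa using hyx
      exact hC 0 hx
    · have hC0 : 0 ≤ C := nonneg_of_mul_nonneg_left hCx (by positivity)
      exact (hC y (hyx.trans hx)).trans (by gcongr)
  have := (convex_uIcc 0 x).norm_image_sub_le_of_norm_hasDerivWithin_le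
    (fun y _ => (hr y).hasDerivWithinAt) hbound Set.left_mem_uIcc Set.right_mem_uIcc
  rw [h0, sub_zero, sub_zero] at this
  simpa [pow_succ, mul_assoc] using this

lemma exists_abs_le_of_continuous {f : ℝ → ℝ} (hf : Continuous f) (M : ℝ) :
    ∃ K, 0 ≤ K ∧ ∀ x, |x| ≤ M → |f x| ≤ K := by
  obtain ⟨K, hK⟩ := (isCompact_Icc (a := -M) (b := M)).exists_bound_of_continuousOn hf.continuousOn
  exact ⟨max K 0, le_max_right _ _, fun x hx => (hK x (abs_le.1 hx)).trans (le_max_left _ _)⟩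

lemma hasDerivAt_iteratedDeriv {f : ℝ → ℝ} (hf : ContDiff ℝ (⊤ : ℕ∞) f) (k : ℕ) (x : ℝ) :
    HasDerivAt (iteratedDeriv k f) (iteratedDeriv (k + 1) f x) x := by
  rw [iteratedDeriv_succ]
  exact (hf.differentiable_iteratedDeriv k (by exact_mod_cast WithTop.coe_lt_top k) x).hasDerivAt

lemma continuous_iteratedDeriv_of_smooth {f : ℝ → ℝ} (hf : ContDiff ℝ (⊤ : ℕ∞) f) (k : ℕ) :
    Continuous (iteratedDeriv k f) :=
  hf.continuous_iteratedDeriv k (by exact_mod_cast le_top)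

/-- Fifth-order expansion of an increment of a smooth function around the midpoint. -/
lemma exists_midpoint_expansion {f : ℝ → ℝ} (hf : ContDiff ℝ (⊤ : ℕ∞) f) (M : ℝ) :
    ∃ C, 0 ≤ C ∧ ∀ a b, |a| ≤ M → |b| ≤ M →
      |f b - f a - deriv f ((a + b) / 2) * (b - a)
        - iteratedDeriv 3 f ((a + b) / 2) / 24 * (b - a) ^ 3| ≤ C * |b - a| ^ 5 := by
  obtain ⟨K, hK0, hK⟩ :=
    exists_abs_le_of_continuous (continuous_iteratedDeriv_of_smooth hf 5) (2 * M)
  refine ⟨2 * K, by positivity, fun a b ha hb => ?_⟩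
  set β := (a + b) / 2 with hβ
  have hβM : |β| ≤ M := by rw [abs_le] at *; constructor <;> linarith
  have hD : ∀ k x, HasDerivAt (iteratedDeriv k f) (iteratedDeriv (k + 1) f x) x :=
    hasDerivAt_iteratedDeriv hf
  have hp : ∀ k x, HasDerivAt (fun h => iteratedDeriv k f (β + h))
      (iteratedDeriv (k + 1) f (β + x)) x := fun k x => (hD k (β + x)).comp_const_add β x
  have hm : ∀ k x, HasDerivAt (fun h => iteratedDeriv k f (β - h))
      (-iteratedDeriv (k + 1) f (β - x)) x := fun k x => by
    simpa using (hD k (β - x)).comp_const_sub β x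
  have s5 : ∀ x, |x| ≤ M → |iteratedDeriv 5 f (β + x) + iteratedDeriv 5 f (β - x)|
      ≤ 2 * K * |x| ^ 0 := by
    intro x hx
    have h1 := hK (β + x) ((abs_add_le _ _).trans (by linarith))
    have h2 := hK (β - x) ((abs_sub _ _).trans (by linarith))
    have := abs_add_le (iteratedDeriv 5 f (β + x)) (iteratedDeriv 5 f (β - x))
    simp only [pow_zero, mul_one]
    linarith
  have s4 : ∀ x, |x| ≤ M → |iteratedDeriv 4 f (β + x) - iteratedDeriv 4 f (β - x)|
      ≤ 2 * K * |x| ^ 1 := fun x hx =>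
    abs_le_of_abs_deriv_le_pow
      (r := fun x => iteratedDeriv 4 f (β + x) - iteratedDeriv 4 f (β - x))
      (fun x => ((hp 4 x).sub (hm 4 x)).congr_deriv (by ring)) (by simp) s5 hx
  have s3 : ∀ x, |x| ≤ M → |iteratedDeriv 3 f (β + x) + iteratedDeriv 3 f (β - x)
      - 2 * iteratedDeriv 3 f β| ≤ 2 * K * |x| ^ 2 := fun x hx =>
    abs_le_of_abs_deriv_le_pow
      (r := fun x => iteratedDeriv 3 f (β + x) + iteratedDeriv 3 f (β - x)
        - 2 * iteratedDeriv 3 f β)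
      (fun x => (((hp 3 x).add (hm 3 x)).sub_const _).congr_deriv (by ring)) (by simp; ring) s4 hx
  have s2 : ∀ x, |x| ≤ M → |iteratedDeriv 2 f (β + x) - iteratedDeriv 2 f (β - x)
      - 2 * iteratedDeriv 3 f β * x| ≤ 2 * K * |x| ^ 3 := fun x hx =>
    abs_le_of_abs_deriv_le_pow
      (r := fun x => iteratedDeriv 2 f (β + x) - iteratedDeriv 2 f (β - x)
        - 2 * iteratedDeriv 3 f β * x)
      (fun x => (((hp 2 x).sub (hm 2 x)).sub
        ((hasDerivAt_id x).const_mul (2 * iteratedDeriv 3 f β))).congr_deriv (by ring))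
      (by simp) s3 hx
  have s1 : ∀ x, |x| ≤ M → |iteratedDeriv 1 f (β + x) + iteratedDeriv 1 f (β - x)
      - 2 * iteratedDeriv 1 f β - iteratedDeriv 3 f β * x ^ 2| ≤ 2 * K * |x| ^ 4 := fun x hx =>
    abs_le_of_abs_deriv_le_pow
      (r := fun x => iteratedDeriv 1 f (β + x) + iteratedDeriv 1 f (β - x)
        - 2 * iteratedDeriv 1 f β - iteratedDeriv 3 f β * x ^ 2)
      (fun x => ((((hp 1 x).add (hm 1 x)).sub_const _).sub
        ((hasDerivAt_pow 2 x).const_mul (iteratedDeriv 3 f β))).congr_deriv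
          (by push_cast; ring))
      (by simp; ring) s2 hx
  have s0 : ∀ x, |x| ≤ M → |iteratedDeriv 0 f (β + x) - iteratedDeriv 0 f (β - x)
      - 2 * iteratedDeriv 1 f β * x - iteratedDeriv 3 f β / 3 * x ^ 3| ≤ 2 * K * |x| ^ 5 :=
    fun x hx => abs_le_of_abs_deriv_le_pow
      (r := fun x => iteratedDeriv 0 f (β + x) - iteratedDeriv 0 f (β - x)
        - 2 * iteratedDeriv 1 f β * x - iteratedDeriv 3 f β / 3 * x ^ 3)
      (fun x => ((((hp 0 x).sub (hm 0 x)).sub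
        ((hasDerivAt_id x).const_mul (2 * iteratedDeriv 1 f β))).sub
        ((hasDerivAt_pow 3 x).const_mul (iteratedDeriv 3 f β / 3))).congr_deriv
          (by push_cast; ring))
      (by simp) s1 hx
  have hh : |(b - a) / 2| ≤ M := by rw [abs_le] at *; constructor <;> linarith
  have h := s0 _ hh
  rw [iteratedDeriv_zero, iteratedDeriv_one, show β + (b - a) / 2 = b by rw [hβ]; ring,
    show β - (b - a) / 2 = a by rw [hβ]; ring] at h
  calc _ = |f b - f a - 2 * deriv f β * ((b - a) / 2)
        - iteratedDeriv 3 f β / 3 * ((b - a) / 2) ^ 3| := by congr 1; ring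
    _ ≤ 2 * K * |(b - a) / 2| ^ 5 := h
    _ ≤ 2 * K * |b - a| ^ 5 := by
        have : |(b - a) / 2| ≤ |b - a| := by
          rw [abs_div, abs_two]
          linarith [abs_nonneg (b - a)]
        gcongr

lemma abs_mul_three_le {x y z X Y Z : ℝ} (hx : |x| ≤ X) (hy : |y| ≤ Y) (hz : |z| ≤ Z) :
    |x * y * z| ≤ X * Y * Z := by
  have := (abs_nonneg x).trans hx
  have := (abs_nonneg y).trans hy
  rw [abs_mul, abs_mul]
  gcongr

/-- The weight of the fifth-order term in the expansion of a product of three increments. -/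
def quinticWeight (f g h : ℝ → ℝ) (x : ℝ) : ℝ :=
  (iteratedDeriv 3 f x * deriv g x * deriv h x + deriv f x * iteratedDeriv 3 g x * deriv h x
    + deriv f x * deriv g x * iteratedDeriv 3 h x) / 24

lemma exists_triple_product_expansion {f g h : ℝ → ℝ} (hf : ContDiff ℝ (⊤ : ℕ∞) f)
    (hg : ContDiff ℝ (⊤ : ℕ∞) g) (hh : ContDiff ℝ (⊤ : ℕ∞) h) (M : ℝ) :
    ∃ C, 0 ≤ C ∧ ∀ a b, |a| ≤ M → |b| ≤ M →
      |(f b - f a) * (g b - g a) * (h b - h a)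
        - deriv f ((a + b) / 2) * deriv g ((a + b) / 2) * deriv h ((a + b) / 2) * (b - a) ^ 3
        - quinticWeight f g h ((a + b) / 2) * (b - a) ^ 5| ≤ C * |b - a| ^ 7 := by
  have key : ∀ u : ℝ → ℝ, ContDiff ℝ (⊤ : ℕ∞) u → ∃ K, 0 ≤ K ∧ ∀ a b, |a| ≤ M → |b| ≤ M →
      ∃ w, u b - u a = (b - a) * (deriv u ((a + b) / 2) + w) ∧
        |deriv u ((a + b) / 2)| ≤ K ∧ |w| ≤ K * (b - a) ^ 2 ∧
        |w - iteratedDeriv 3 u ((a + b) / 2) / 24 * (b - a) ^ 2| ≤ K * (b - a) ^ 4 := by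
    intro u hu
    obtain ⟨C, hC0, hC⟩ := exists_midpoint_expansion hu M
    obtain ⟨K1, hK10, hK1⟩ :=
      exists_abs_le_of_continuous (continuous_iteratedDeriv_of_smooth hu 1) M
    obtain ⟨K3, hK30, hK3⟩ :=
      exists_abs_le_of_continuous (continuous_iteratedDeriv_of_smooth hu 3) M
    refine ⟨K1 + K3 + C + C * (2 * M) ^ 2, by positivity, fun a b ha hb => ?_⟩
    have hβM : |(a + b) / 2| ≤ M := by rw [abs_le] at *; constructor <;> linarith
    have h1 := hK1 _ hβM
    rw [iteratedDeriv_one] at h1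
    have hM2 : 0 ≤ C * (2 * M) ^ 2 := by positivity
    rcases eq_or_ne b a with rfl | hab
    · exact ⟨0, by simp, by linarith, by simp, by simp⟩
    have hs : (b - a) ^ 2 ≤ (2 * M) ^ 2 := by
      rw [← sq_abs]
      gcongr
      exact (abs_sub _ _).trans (by linarith)
    have hd : 0 < |b - a| := abs_pos.2 (sub_ne_zero.2 hab)
    have h3 := hK3 _ hβM
    set q := iteratedDeriv 3 u ((a + b) / 2)
    set p := deriv u ((a + b) / 2)
    have hw : |(u b - u a) / (b - a) - p - q / 24 * (b - a) ^ 2| ≤ C * (b - a) ^ 4 := by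
      rw [← mul_le_mul_iff_right₀ hd, ← abs_mul]
      have e1 : (b - a) * ((u b - u a) / (b - a) - p - q / 24 * (b - a) ^ 2)
          = u b - u a - p * (b - a) - q / 24 * (b - a) ^ 3 := by
        have := sub_ne_zero.2 hab
        field_simp
      have e2 : |b - a| * (C * (b - a) ^ 4) = C * |b - a| ^ 5 := by
        rw [← Even.pow_abs (by decide : Even 4) (b - a)]; ring
      rw [e1, e2]
      exact hC a b ha hb
    refine ⟨(u b - u a) / (b - a) - p, ?_, by linarith, ?_, hw.trans ?_⟩
    · have := sub_ne_zero.2 hab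
      field_simp
      ring
    · have t1 : |q / 24 * (b - a) ^ 2| ≤ K3 * (b - a) ^ 2 := by
        rw [abs_mul, abs_div, abs_of_nonneg (sq_nonneg (b - a))]
        gcongr
        rw [abs_of_pos (by norm_num : (0 : ℝ) < 24)]
        linarith [abs_nonneg q]
      have t2 : C * (b - a) ^ 4 ≤ C * (2 * M) ^ 2 * (b - a) ^ 2 := by
        calc C * (b - a) ^ 4 = C * (b - a) ^ 2 * (b - a) ^ 2 := by ring
          _ ≤ _ := by gcongr
      have t3 := abs_add_le ((u b - u a) / (b - a) - p - q / 24 * (b - a) ^ 2)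
        (q / 24 * (b - a) ^ 2)
      rw [sub_add_cancel] at t3
      have t4 : 0 ≤ (K1 + C) * (b - a) ^ 2 := by positivity
      nlinarith
    · gcongr
      linarith
  obtain ⟨K1, h10, h1⟩ := key f hf
  obtain ⟨K2, h20, h2⟩ := key g hg
  obtain ⟨K3, h30, h3⟩ := key h hh
  refine ⟨6 * (K1 * K2 * K3) + K1 * K2 * K3 * (2 * M) ^ 2, by positivity, fun a b ha hb => ?_⟩
  obtain ⟨w1, e1, p1, b1, c1⟩ := h1 a b ha hb
  obtain ⟨w2, e2, p2, b2, c2⟩ := h2 a b ha hb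
  obtain ⟨w3, e3, p3, b3, c3⟩ := h3 a b ha hb
  rw [e1, e2, e3, quinticWeight]
  have hs : (b - a) ^ 2 ≤ (2 * M) ^ 2 := by
    rw [← sq_abs]
    gcongr
    exact (abs_sub _ _).trans (by linarith)
  set d := b - a
  set β := (a + b) / 2
  have t1 := abs_mul_three_le c1 p2 p3
  have t2 := abs_mul_three_le p1 c2 p3
  have t3 := abs_mul_three_le p1 p2 c3
  have t4 := abs_mul_three_le b1 b2 p3
  have t5 := abs_mul_three_le b1 p2 b3
  have t6 := abs_mul_three_le p1 b2 b3
  have t7 := abs_mul_three_le b1 b2 b3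
  have t8 : K1 * d ^ 2 * (K2 * d ^ 2) * (K3 * d ^ 2) ≤ K1 * K2 * K3 * (2 * M) ^ 2 * d ^ 4 := by
    calc _ = K1 * K2 * K3 * d ^ 2 * d ^ 4 := by ring
      _ ≤ _ := by gcongr
  rw [show ∀ A B D : ℝ, d * A * (d * B) * (d * D) = d ^ 3 * (A * B * D) by intros; ring]
  have e : |d| ^ 7 = |d ^ 3| * d ^ 4 := by
    rw [← Even.pow_abs (by decide : Even 4) d, abs_pow]; ring
  rw [e, mul_left_comm _ |d ^ 3| (d ^ 4)]
  rw [show ∀ x y z : ℝ, d ^ 3 * x - y * d ^ 3 - z * d ^ 5 = d ^ 3 * (x - y - z * d ^ 2) by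
    intros; ring, abs_mul]
  gcongr
  rw [abs_le] at *
  constructor <;> linarith

end Taylor

section GaussianMoments

/-- The absolute moments of the standard Gaussian distribution. -/
def absMoment (p : ℕ) : ℝ := ∫ x, |x| ^ p ∂gaussianReal 0 1

lemma absMoment_nonneg (p : ℕ) : 0 ≤ absMoment p := integral_nonneg fun _ => by positivity

variable {Ω : Type*} [MeasurableSpace Ω] {P : Measure Ω} {X D U V : Ω → ℝ} {σ : ℝ}

lemma integrable_abs_pow_of_map_eq {v : NNReal} (hX : Measurable X)
    (hlaw : P.map X = gaussianReal 0 v) (p : ℕ) : Integrable (fun ω => |X ω| ^ p) P := by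
  have h : Integrable (fun x : ℝ => |x| ^ p) (gaussianReal 0 v) := by
    simpa using (memLp_id_gaussianReal (μ := 0) (v := v) p).integrable_norm_pow'
  rw [← hlaw] at h
  exact h.comp_measurable hX

lemma integral_abs_pow_of_map_eq (hσ : 0 ≤ σ) (hX : Measurable X)
    (hlaw : P.map X = gaussianReal 0 (σ ^ 2).toNNReal) (p : ℕ) :
    ∫ ω, |X ω| ^ p ∂P = σ ^ p * absMoment p := by
  have hstd : gaussianReal 0 (σ ^ 2).toNNReal = (gaussianReal 0 1).map (σ * ·) := by
    rw [gaussianReal_map_const_mul, mul_zero, mul_one]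
    congr 1
    ext
    simp [sq_nonneg]
  have h1 : ∫ ω, |X ω| ^ p ∂P = ∫ x, |x| ^ p ∂(P.map X) :=
    (integral_map (f := fun x : ℝ => |x| ^ p) hX.aemeasurable (by fun_prop)).symm
  rw [h1, hlaw, hstd, integral_map (by fun_prop) (by fun_prop), absMoment, ← integral_const_mul]
  simp_rw [abs_mul, mul_pow, abs_of_nonneg hσ]

lemma integral_pow_five_eq_zero {v : NNReal} (hX : Measurable X)
    (hlaw : P.map X = gaussianReal 0 v) : ∫ ω, X ω ^ 5 ∂P = 0 := by
  have h1 : ∫ ω, X ω ^ 5 ∂P = ∫ x, x ^ 5 ∂(P.map X) :=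
    (integral_map (f := fun x : ℝ => x ^ 5) hX.aemeasurable (by fun_prop)).symm
  have h2 : ∫ x, x ^ 5 ∂(gaussianReal 0 v) = ∫ x, (-x) ^ 5 ∂(gaussianReal 0 v) := by
    conv_lhs => rw [← neg_zero, ← gaussianReal_map_neg]
    rw [integral_map (by fun_prop) (by fun_prop)]
  rw [h1, hlaw]
  simp_rw [Odd.neg_pow (by decide : Odd 5), integral_neg] at h2
  linarith

lemma integral_add_abs_pow_le (hσ : 0 ≤ σ) (hX : Measurable X) (hD : Measurable D)
    (hlawX : P.map X = gaussianReal 0 (σ ^ 2).toNNReal)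
    (hlawD : P.map D = gaussianReal 0 (σ ^ 2).toNNReal) {p : ℕ} (hp : p ≠ 0) :
    Integrable (fun ω => (|X ω| + |D ω|) ^ p) P ∧
      ∫ ω, (|X ω| + |D ω|) ^ p ∂P ≤ 2 ^ p * σ ^ p * absMoment p := by
  have iX := integrable_abs_pow_of_map_eq hX hlawX p
  have iD := integrable_abs_pow_of_map_eq hD hlawD p
  have hle : ∀ ω, (|X ω| + |D ω|) ^ p ≤ 2 ^ (p - 1) * (|X ω| ^ p + |D ω| ^ p) := fun ω =>
    add_pow_le (abs_nonneg _) (abs_nonneg _) p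
  have hint : Integrable (fun ω => 2 ^ (p - 1) * (|X ω| ^ p + |D ω| ^ p)) P :=
    (iX.add iD).const_mul _
  have hV : Integrable (fun ω => (|X ω| + |D ω|) ^ p) P :=
    hint.mono' (by fun_prop) (ae_of_all _ fun ω => by
      rw [Real.norm_of_nonneg (by positivity)]
      exact hle ω)
  refine ⟨hV, (integral_mono hV hint hle).trans ?_⟩
  rw [integral_const_mul, integral_add iX iD, integral_abs_pow_of_map_eq hσ hX hlawX,
    integral_abs_pow_of_map_eq hσ hD hlawD]
  have := absMoment_nonneg p
  have h0 : 0 ≤ σ ^ p * absMoment p := by positivity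
  obtain ⟨q, rfl⟩ := Nat.exists_eq_succ_of_ne_zero hp
  rw [Nat.succ_sub_one, pow_succ 2 q]
  linarith

/-- A product of fifth powers of two jointly Gaussian variables, weighted by Lipschitz functions of
two further ones, has an expectation that is linear in the correlations with the first variable. -/
lemma abs_integral_pow_five_mul_le [IsProbabilityMeasure P] {c₁ c₂ c₃ K : ℝ} {ψ : ℝ → ℝ}
    (hX : Measurable X) (hD : Measurable D) (hU : Measurable U) (hV : Measurable V)
    (hG : HasGaussianLaw (fun ω => ![X ω, D ω, U ω, V ω]) P) (hσ : 0 < σ)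
    (hlawX : P.map X = gaussianReal 0 (σ ^ 2).toNNReal)
    (hlawD : P.map D = gaussianReal 0 (σ ^ 2).toNNReal)
    (h₁ : cov[X, D; P] = c₁ * σ ^ 2) (h₂ : cov[X, U; P] = c₂ * σ ^ 2)
    (h₃ : cov[X, V; P] = c₃ * σ ^ 2) (hc₁ : |c₁| ≤ 1)
    (hψK : ∀ x, |ψ x| ≤ K) (hψL : ∀ x y, |ψ x - ψ y| ≤ K * |x - y|) :
    |∫ ω, (ψ (U ω) * X ω ^ 5) * (ψ (V ω) * D ω ^ 5) ∂P| ≤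
      5 * 2 ^ 10 * absMoment 10 * K ^ 2 * σ ^ 10 * |c₁|
        + 2 ^ 11 * absMoment 11 * K ^ 2 * σ ^ 11 * (|c₂| + |c₃|) := by
  have hK : 0 ≤ K := (abs_nonneg _).trans (hψK 0)
  have hψc : Continuous ψ :=
    (LipschitzWith.of_dist_le_mul (K := ⟨K, hK⟩) fun x y => hψL x y).continuous
  have hψm : Measurable ψ := hψc.measurable
  let e : Fin 4 → (Fin 4 → ℝ) →L[ℝ] ℝ := fun i => ContinuousLinearMap.proj i
  have mX : MemLp X 2 P := (hG.map (e 0)).memLp_two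
  have mD : MemLp D 2 P := (hG.map (e 1)).memLp_two
  have mU : MemLp U 2 P := (hG.map (e 2)).memLp_two
  have mV : MemLp V 2 P := (hG.map (e 3)).memLp_two
  have hvar : cov[X, X; P] = σ ^ 2 := by
    rw [covariance_self hX.aemeasurable, ← variance_id_map hX.aemeasurable, hlawX,
      variance_id_gaussianReal]
    simp [sq_nonneg]
  have hres : ∀ (W : Ω → ℝ) (c : ℝ), MemLp W 2 P → cov[X, W; P] = c * σ ^ 2 →
      cov[X, fun ω => W ω - c * X ω; P] = 0 := by
    intro W c mW hW
    rw [covariance_fun_sub_right mX mW (mX.const_mul c), covariance_const_mul_right, hvar, hW,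
      sub_self]
  set R₁ : Ω → ℝ := fun ω => D ω - c₁ * X ω with hR₁
  set R₂ : Ω → ℝ := fun ω => U ω - c₂ * X ω with hR₂
  set R₃ : Ω → ℝ := fun ω => V ω - c₃ * X ω with hR₃
  have hind : IndepFun (fun ω => (fun _ : Fin 1 => X ω)) (fun ω => (fun j => ![R₁, R₂, R₃] j ω))
      P := by
    refine HasGaussianLaw.indepFun_of_covariance_eval (X := fun _ : Fin 1 => X)
      (Y := ![R₁, R₂, R₃]) ?_ ?_
    · let L : (Fin 4 → ℝ) →L[ℝ] (Fin 1 → ℝ) × (Fin 3 → ℝ) :=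
        (ContinuousLinearMap.pi fun _ => e 0).prod
          (ContinuousLinearMap.pi ![e 1 - c₁ • e 0, e 2 - c₂ • e 0, e 3 - c₃ • e 0])
      have hL : (fun ω => (fun _ : Fin 1 => X ω, fun j => ![R₁, R₂, R₃] j ω))
          = L ∘ fun ω => ![X ω, D ω, U ω, V ω] := by
        funext ω
        refine Prod.ext (funext fun j => ?_) (funext fun j => ?_)
        · simp [L, e]
        · fin_cases j <;> simp [L, e, hR₁, hR₂, hR₃]
      rw [hL]
      exact hG.map L
    · intro _ j
      fin_cases j
      exacts [hres D c₁ mD h₁, hres U c₂ mU h₂, hres V c₃ mV h₃]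
  have hzero : ∫ ω, X ω ^ 5 * (R₁ ω ^ 5 * (ψ (R₂ ω) * ψ (R₃ ω))) ∂P = 0 := by
    have := hind.integral_fun_comp_mul_comp (f := fun x => x 0 ^ 5)
      (g := fun r => r 0 ^ 5 * (ψ (r 1) * ψ (r 2))) (by fun_prop)
      (measurable_pi_lambda _ fun j => by fin_cases j <;> simp [hR₁, hR₂, hR₃] <;> fun_prop).aemeasurable
      (Measurable.aestronglyMeasurable (by fun_prop))
      (Measurable.aestronglyMeasurable (by fun_prop))
    simp only [Matrix.cons_val_zero, Matrix.cons_val_one, Matrix.cons_val] at this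
    rw [this, integral_pow_five_eq_zero hX hlawX, zero_mul]
  obtain ⟨i10, b10⟩ := integral_add_abs_pow_le hσ.le hX hD hlawX hlawD (by norm_num : 10 ≠ 0)
  obtain ⟨i11, b11⟩ := integral_add_abs_pow_le hσ.le hX hD hlawX hlawD (by norm_num : 11 ≠ 0)
  have hRle : ∀ ω, |R₁ ω| ≤ |X ω| + |D ω| := fun ω => by
    have h1 := abs_sub (D ω) (c₁ * X ω)
    have h2 : |c₁ * X ω| ≤ 1 * |X ω| := by rw [abs_mul]; gcongr
    linarith
  have hprod : ∀ x y, |ψ x * ψ y| ≤ K ^ 2 := fun x y => by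
    rw [abs_mul, sq]
    exact mul_le_mul (hψK x) (hψK y) (abs_nonneg _) hK
  have iA : Integrable (fun ω => (ψ (U ω) * X ω ^ 5) * (ψ (V ω) * D ω ^ 5)) P := by
    refine (i10.const_mul (K ^ 2)).mono' (by fun_prop) (ae_of_all _ fun ω => ?_)
    rw [Real.norm_eq_abs, show (ψ (U ω) * X ω ^ 5) * (ψ (V ω) * D ω ^ 5)
      = (ψ (U ω) * ψ (V ω)) * (X ω ^ 5 * D ω ^ 5) by ring,
      abs_mul (ψ (U ω) * ψ (V ω)), abs_mul (X ω ^ 5), abs_pow, abs_pow]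
    have hx : |X ω| ≤ |X ω| + |D ω| := by linarith [abs_nonneg (D ω)]
    have hd : |D ω| ≤ |X ω| + |D ω| := by linarith [abs_nonneg (X ω)]
    calc _ ≤ K ^ 2 * ((|X ω| + |D ω|) ^ 5 * (|X ω| + |D ω|) ^ 5) := by
          gcongr
          exact hprod _ _
      _ = _ := by ring
  have iB : Integrable (fun ω => X ω ^ 5 * (R₁ ω ^ 5 * (ψ (R₂ ω) * ψ (R₃ ω)))) P := by
    refine (i10.const_mul (K ^ 2)).mono' (by fun_prop) (ae_of_all _ fun ω => ?_)
    rw [Real.norm_eq_abs, abs_mul, abs_mul, abs_pow, abs_pow]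
    have hx : |X ω| ≤ |X ω| + |D ω| := by linarith [abs_nonneg (D ω)]
    calc _ ≤ (|X ω| + |D ω|) ^ 5 * ((|X ω| + |D ω|) ^ 5 * K ^ 2) := by
          gcongr
          exacts [hRle ω, hprod _ _]
      _ = _ := by ring
  have hpt : ∀ ω, |(ψ (U ω) * X ω ^ 5) * (ψ (V ω) * D ω ^ 5)
        - X ω ^ 5 * (R₁ ω ^ 5 * (ψ (R₂ ω) * ψ (R₃ ω)))|
      ≤ 5 * K ^ 2 * |c₁| * (|X ω| + |D ω|) ^ 10
        + K ^ 2 * (|c₂| + |c₃|) * (|X ω| + |D ω|) ^ 11 := by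
    intro ω
    set W := |X ω| + |D ω| with hW
    have hx : |X ω| ≤ W := by linarith [abs_nonneg (D ω)]
    have hd : |D ω| ≤ W := by linarith [abs_nonneg (X ω)]
    have hr := hRle ω
    have hW0 : 0 ≤ W := by positivity
    have d5 : |D ω ^ 5 - R₁ ω ^ 5| ≤ 5 * |c₁| * W ^ 5 := by
      have e : D ω ^ 5 - R₁ ω ^ 5 = (c₁ * X ω) * (D ω ^ 4 + D ω ^ 3 * R₁ ω + D ω ^ 2 * R₁ ω ^ 2
          + D ω * R₁ ω ^ 3 + R₁ ω ^ 4) := by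
        rw [show c₁ * X ω = D ω - R₁ ω by simp [hR₁]]; ring
      have h4 : |D ω ^ 4 + D ω ^ 3 * R₁ ω + D ω ^ 2 * R₁ ω ^ 2 + D ω * R₁ ω ^ 3 + R₁ ω ^ 4|
          ≤ |D ω| ^ 4 + |D ω| ^ 3 * |R₁ ω| + |D ω| ^ 2 * |R₁ ω| ^ 2 + |D ω| * |R₁ ω| ^ 3
            + |R₁ ω| ^ 4 := by
        simp only [← abs_pow, ← abs_mul]
        refine (abs_add_le _ _).trans (add_le_add_left ?_ _)
        refine (abs_add_le _ _).trans (add_le_add_left ?_ _)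
        refine (abs_add_le _ _).trans (add_le_add_left ?_ _)
        exact abs_add_le _ _
      rw [e, abs_mul, abs_mul]
      calc _ ≤ |c₁| * W * (W ^ 4 + W ^ 3 * W + W ^ 2 * W ^ 2 + W * W ^ 3 + W ^ 4) := by
            gcongr
            exact h4.trans (by gcongr)
        _ = _ := by ring
    have dψ : |ψ (U ω) * ψ (V ω) - ψ (R₂ ω) * ψ (R₃ ω)| ≤ K ^ 2 * (|c₂| + |c₃|) * W := by
      have u := hψL (U ω) (R₂ ω)
      have v := hψL (V ω) (R₃ ω)
      rw [show U ω - R₂ ω = c₂ * X ω by simp [hR₂], abs_mul] at u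
      rw [show V ω - R₃ ω = c₃ * X ω by simp [hR₃], abs_mul] at v
      rw [show ψ (U ω) * ψ (V ω) - ψ (R₂ ω) * ψ (R₃ ω)
        = (ψ (U ω) - ψ (R₂ ω)) * ψ (V ω) + ψ (R₂ ω) * (ψ (V ω) - ψ (R₃ ω)) by ring]
      refine (abs_add_le _ _).trans ?_
      rw [abs_mul, abs_mul]
      calc _ ≤ (K * (|c₂| * W)) * K + K * (K * (|c₃| * W)) := by
            gcongr
            exacts [u.trans (by gcongr), hψK _, hψK _, v.trans (by gcongr)]
        _ = _ := by ring
    rw [show (ψ (U ω) * X ω ^ 5) * (ψ (V ω) * D ω ^ 5)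
        - X ω ^ 5 * (R₁ ω ^ 5 * (ψ (R₂ ω) * ψ (R₃ ω)))
      = X ω ^ 5 * ((D ω ^ 5 - R₁ ω ^ 5) * (ψ (U ω) * ψ (V ω)))
        + X ω ^ 5 * (R₁ ω ^ 5 * (ψ (U ω) * ψ (V ω) - ψ (R₂ ω) * ψ (R₃ ω))) by ring]
    refine (abs_add_le _ _).trans ?_
    rw [abs_mul (X ω ^ 5), abs_mul (D ω ^ 5 - R₁ ω ^ 5), abs_mul (X ω ^ 5),
      abs_mul (R₁ ω ^ 5), abs_pow (X ω), abs_pow (R₁ ω)]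
    calc _ ≤ W ^ 5 * ((5 * |c₁| * W ^ 5) * K ^ 2)
          + W ^ 5 * (W ^ 5 * (K ^ 2 * (|c₂| + |c₃|) * W)) := by
          gcongr
          exact hprod _ _
      _ = _ := by ring
  have hint : Integrable (fun ω => 5 * K ^ 2 * |c₁| * (|X ω| + |D ω|) ^ 10
      + K ^ 2 * (|c₂| + |c₃|) * (|X ω| + |D ω|) ^ 11) P :=
    (i10.const_mul _).add (i11.const_mul _)
  calc _ = |∫ ω, ((ψ (U ω) * X ω ^ 5) * (ψ (V ω) * D ω ^ 5)
        - X ω ^ 5 * (R₁ ω ^ 5 * (ψ (R₂ ω) * ψ (R₃ ω)))) ∂P| := by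
        rw [integral_sub iA iB, hzero, sub_zero]
    _ ≤ ∫ ω, (5 * K ^ 2 * |c₁| * (|X ω| + |D ω|) ^ 10
      + K ^ 2 * (|c₂| + |c₃|) * (|X ω| + |D ω|) ^ 11) ∂P :=
        abs_integral_le_integral_abs.trans (integral_mono (iA.sub iB).abs hint hpt)
    _ = 5 * K ^ 2 * |c₁| * ∫ ω, (|X ω| + |D ω|) ^ 10 ∂P
      + K ^ 2 * (|c₂| + |c₃|) * ∫ ω, (|X ω| + |D ω|) ^ 11 ∂P := by
        rw [integral_add (i10.const_mul _) (i11.const_mul _), integral_const_mul,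
          integral_const_mul]
    _ ≤ 5 * K ^ 2 * |c₁| * (2 ^ 10 * σ ^ 10 * absMoment 10)
      + K ^ 2 * (|c₂| + |c₃|) * (2 ^ 11 * σ ^ 11 * absMoment 11) := by gcongr
    _ = _ := by ring

end GaussianMoments

section Grid

/-- The cube root of a natural number. -/
def cbrt (a : ℕ) : ℝ := (a : ℝ) ^ ((1 : ℝ) / 3)

/-- The increments of the cube root along the natural numbers. -/
def cbrtStep (a : ℕ) : ℝ := cbrt (a + 1) - cbrt a

lemma cbrt_zero : cbrt 0 = 0 := by simp [cbrt]

lemma cbrt_one : cbrt 1 = 1 := by simp [cbrt]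

lemma cbrt_mono : Monotone cbrt := fun a b hab => by
  unfold cbrt
  gcongr

lemma cbrtStep_zero : cbrtStep 0 = 1 := by simp [cbrtStep, cbrt_zero, cbrt_one]

lemma cbrtStep_nonneg (a : ℕ) : 0 ≤ cbrtStep a := sub_nonneg.2 (cbrt_mono a.le_succ)

lemma cbrtStep_antitone : Antitone cbrtStep := antitone_nat_of_succ_le fun a => by
  have h := (Real.concaveOn_rpow (p := 1 / 3) (by norm_num) (by norm_num)).2
    (Set.mem_Ici.2 (by positivity : (0 : ℝ) ≤ a)) (Set.mem_Ici.2 (by positivity : (0 : ℝ) ≤ a + 2))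
    (by norm_num : (0 : ℝ) ≤ 1 / 2) (by norm_num : (0 : ℝ) ≤ 1 / 2) (by norm_num)
  simp only [smul_eq_mul] at h
  rw [show (1 / 2 : ℝ) * a + 1 / 2 * (a + 2) = a + 1 by ring] at h
  simp only [cbrtStep, cbrt]
  push_cast
  rw [show (a : ℝ) + 1 + 1 = a + 2 by ring]
  linarith

lemma sum_cbrtStep (k : ℕ) : ∑ i ∈ Finset.range k, cbrtStep i = cbrt k := by
  simp only [cbrtStep]
  rw [Finset.sum_range_sub, cbrt_zero, sub_zero]

variable {Ω : Type*} [MeasureSpace Ω] {B : ℝ → Ω → ℝ}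

lemma IsFBM16.hasGaussianLaw (hB : IsFBM16 B) {m : ℕ} (t : Fin m → ℝ) (ht : ∀ i, 0 ≤ t i) :
    HasGaussianLaw (fun ω i => B (t i) ω) volume := by
  have hmeas : Measurable fun ω i => B (t i) ω := measurable_pi_lambda _ fun i => hB.1 (t i)
  refine ⟨isGaussian_of_map_eq_gaussianReal fun L => ?_⟩
  obtain ⟨v, hv⟩ := hB.2.2.1 m t (fun i => L (Pi.single i 1)) ht
  refine ⟨0, v, ?_⟩
  rw [Measure.map_map (by fun_prop) hmeas, ← hv]
  congr 1
  funext ω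
  rw [Function.comp_apply, ← ContinuousLinearMap.coe_coe, LinearMap.pi_apply_eq_sum_univ]
  refine Finset.sum_congr rfl fun i _ => ?_
  rw [smul_eq_mul, mul_comm, ContinuousLinearMap.coe_coe]
  congr 2
  funext j
  simp [Pi.single_apply, eq_comm]

lemma IsFBM16.map_sub (hB : IsFBM16 B) {s t : ℝ} (hs : 0 ≤ s) (ht : 0 ≤ t) :
    ∃ v : NNReal, Measure.map (fun ω => B t ω - B s ω) volume = gaussianReal 0 v := by
  obtain ⟨v, hv⟩ := hB.2.2.1 2 ![s, t] ![-1, 1] (by simp [Fin.forall_fin_two, hs, ht])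
  refine ⟨v, ?_⟩
  rw [← hv]
  congr 1
  funext ω
  simp [Fin.sum_univ_two]
  ring

lemma IsFBM16.map_eq (hB : IsFBM16 B) {t : ℝ} (ht : 0 ≤ t) :
    ∃ v : NNReal, Measure.map (B t) volume = gaussianReal 0 v := by
  obtain ⟨v, hv⟩ := hB.2.2.1 1 ![t] ![1] (by simp [ht])
  refine ⟨v, ?_⟩
  rw [← hv]
  congr 1
  funext ω
  simp

lemma IsFBM16.memLp_two (hB : IsFBM16 B) {t : ℝ} (ht : 0 ≤ t) : MemLp (B t) 2 volume := by
  obtain ⟨v, hv⟩ := hB.map_eq ht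
  have h := memLp_id_gaussianReal' (μ := 0) (v := v) 2 (by simp)
  rw [← hv, memLp_map_measure_iff aestronglyMeasurable_id (hB.1 t).aemeasurable] at h
  exact h

lemma IsFBM16.integral_eq_zero (hB : IsFBM16 B) {t : ℝ} (ht : 0 ≤ t) : ∫ ω, B t ω = 0 := by
  obtain ⟨v, hv⟩ := hB.map_eq ht
  have h := integral_id_gaussianReal (μ := 0) (v := v)
  rw [← hv, integral_map (hB.1 t).aemeasurable (by fun_prop)] at h
  exact h

/-- The increment of `B` over the `j`-th interval of the grid of mesh `1 / n`. -/
def gridIncr (B : ℝ → Ω → ℝ) (n j : ℕ) (ω : Ω) : ℝ := B ((j + 1 : ℕ) / n) ω - B (j / n) ω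

/-- The average of `B` over the endpoints of the `j`-th interval of the grid of mesh `1 / n`. -/
def gridMid (B : ℝ → Ω → ℝ) (n j : ℕ) (ω : Ω) : ℝ := (B (j / n) ω + B ((j + 1 : ℕ) / n) ω) / 2

lemma IsFBM16.measurable_gridIncr (hB : IsFBM16 B) (n j : ℕ) : Measurable (gridIncr B n j) :=
  (hB.1 _).sub (hB.1 _)

lemma IsFBM16.measurable_gridMid (hB : IsFBM16 B) (n j : ℕ) : Measurable (gridMid B n j) :=
  ((hB.1 _).add (hB.1 _)).div_const 2

lemma IsFBM16.memLp_gridIncr (hB : IsFBM16 B) (n j : ℕ) : MemLp (gridIncr B n j) 2 volume :=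
  (hB.memLp_two (by positivity)).sub (hB.memLp_two (by positivity))

variable [IsProbabilityMeasure (volume : Measure Ω)] {n : ℕ} {σ : ℝ}

lemma IsFBM16.covariance_grid (hB : IsFBM16 B) (hσ : σ ^ 2 * cbrt n = 1) (a d : ℕ) :
    cov[B (a / n), B ((a + d : ℕ) / n)] = σ ^ 2 * ((cbrt a + cbrt (a + d) - cbrt d) / 2) := by
  have ha : (0 : ℝ) ≤ a / n := by positivity
  have hb : (0 : ℝ) ≤ (a + d : ℕ) / n := by positivity
  have hn : cbrt n ≠ 0 := right_ne_zero_of_mul_eq_one hσ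
  rw [covariance_eq_sub (hB.memLp_two ha) (hB.memLp_two hb), hB.integral_eq_zero ha, zero_mul,
    sub_zero]
  have h := hB.2.2.2 _ _ ha hb
  simp only [Pi.mul_apply]
  rw [h, ← sub_div, show ((a + d : ℕ) : ℝ) - a = d by push_cast; ring,
    abs_of_nonneg (by positivity), Real.div_rpow (by positivity) (by positivity),
    Real.div_rpow (by positivity) (by positivity), Real.div_rpow (by positivity) (by positivity)]
  change (cbrt (a + d) / cbrt n + cbrt a / cbrt n - cbrt d / cbrt n) / 2 = _
  rw [eq_div_of_mul_eq hn hσ]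
  ring

lemma IsFBM16.covariance_gridIncr_right (hB : IsFBM16 B) (hσ : σ ^ 2 * cbrt n = 1) (i s : ℕ) :
    cov[gridIncr B n i, B ((i + 1 + s : ℕ) / n)] = (cbrtStep i + cbrtStep s) / 2 * σ ^ 2 := by
  have h1 := hB.covariance_grid hσ (i + 1) s
  have h2 := hB.covariance_grid hσ i (1 + s)
  rw [← add_assoc] at h2
  unfold gridIncr
  rw [covariance_fun_sub_left (hB.memLp_two (by positivity)) (hB.memLp_two (by positivity))
    (hB.memLp_two (by positivity)), h1, h2, cbrtStep, cbrtStep, add_comm 1 s]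
  ring

lemma IsFBM16.covariance_gridIncr_left (hB : IsFBM16 B) (hσ : σ ^ 2 * cbrt n = 1) (i : ℕ) :
    cov[gridIncr B n i, B (i / n)] = (cbrtStep i - 1) / 2 * σ ^ 2 := by
  have h1 := hB.covariance_grid hσ i 1
  have h2 := hB.covariance_grid hσ i 0
  rw [add_zero] at h2
  unfold gridIncr
  rw [covariance_fun_sub_left (hB.memLp_two (by positivity)) (hB.memLp_two (by positivity))
    (hB.memLp_two (by positivity)), covariance_comm, h1, h2, cbrtStep, cbrt_one, cbrt_zero]
  ring

lemma covariance_gridMid (hB : IsFBM16 B) (n j : ℕ) {X : Ω → ℝ} (hX : MemLp X 2 volume) :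
    cov[X, gridMid B n j] = (cov[X, B (j / n)] + cov[X, B ((j + 1 : ℕ) / n)]) / 2 := by
  unfold gridMid
  rw [covariance_fun_div_right]
  congr 1
  exact covariance_add_right hX (hB.memLp_two (by positivity)) (hB.memLp_two (by positivity))

lemma covariance_gridIncr (hB : IsFBM16 B) (n j : ℕ) {X : Ω → ℝ} (hX : MemLp X 2 volume) :
    cov[X, gridIncr B n j] = cov[X, B ((j + 1 : ℕ) / n)] - cov[X, B (j / n)] :=
  covariance_sub_right hX (hB.memLp_two (by positivity)) (hB.memLp_two (by positivity))

lemma IsFBM16.map_gridIncr (hB : IsFBM16 B) (hσ : σ ^ 2 * cbrt n = 1) (i : ℕ) :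
    Measure.map (gridIncr B n i) volume = gaussianReal 0 (σ ^ 2).toNNReal := by
  obtain ⟨v, hv⟩ := hB.map_sub (s := i / n) (t := (i + 1 : ℕ) / n) (by positivity) (by positivity)
  change Measure.map (gridIncr B n i) volume = _ at hv
  have hm := (hB.measurable_gridIncr n i).aemeasurable (μ := volume)
  have hvar : cov[gridIncr B n i, gridIncr B n i] = v := by
    rw [covariance_self hm, ← variance_id_map hm, hv, variance_id_gaussianReal]
  have h := hB.covariance_gridIncr_right hσ i 0
  rw [covariance_gridIncr hB n i (hB.memLp_gridIncr n i), hB.covariance_gridIncr_left hσ,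
    ← add_zero (i + 1), h, cbrtStep_zero] at hvar
  rw [hv]
  congr 1
  ext
  rw [← hvar, Real.coe_toNNReal _ (sq_nonneg σ)]
  ring

/-- The weighted fifth power of an increment. -/
def gridTerm (ψ : ℝ → ℝ) (B : ℝ → Ω → ℝ) (n j : ℕ) (ω : Ω) : ℝ :=
  ψ (gridMid B n j ω) * gridIncr B n j ω ^ 5

/-- The constant controlling the second moments of weighted sums of fifth powers. -/
def quinticConst (K : ℝ) : ℝ := (5 * 2 ^ 10 * absMoment 10 + 2 ^ 11 * absMoment 11) * K ^ 2

lemma quinticConst_nonneg (K : ℝ) : 0 ≤ quinticConst K := by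
  have := absMoment_nonneg 10
  have := absMoment_nonneg 11
  unfold quinticConst
  positivity

variable {K : ℝ} {ψ : ℝ → ℝ}

lemma IsFBM16.abs_integral_gridTerm_mul_le (hB : IsFBM16 B) (hσ0 : 0 < σ)
    (hσ : σ ^ 2 * cbrt n = 1) (hψK : ∀ x, |ψ x| ≤ K)
    (hψL : ∀ x y, |ψ x - ψ y| ≤ K * |x - y|) (i s : ℕ) :
    |∫ ω, gridTerm ψ B n i ω * gridTerm ψ B n (i + 1 + s) ω| ≤
      quinticConst K * (σ ^ 10 * (cbrtStep s - cbrtStep (s + 1))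
        + σ ^ 11 * (cbrtStep i + cbrtStep s)) := by
  have mI := hB.memLp_gridIncr n i
  have hr := hB.covariance_gridIncr_right hσ i
  have h₁ : cov[gridIncr B n i, gridIncr B n (i + 1 + s)]
      = (cbrtStep (s + 1) - cbrtStep s) / 2 * σ ^ 2 := by
    rw [covariance_gridIncr hB _ _ mI, hr, show i + 1 + s + 1 = i + 1 + (s + 1) by ring, hr]
    ring
  have h₂ : cov[gridIncr B n i, gridMid B n i] = cbrtStep i / 2 * σ ^ 2 := by
    have h := hr 0
    rw [add_zero] at h
    rw [covariance_gridMid hB _ _ mI, h, hB.covariance_gridIncr_left hσ, cbrtStep_zero]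
    ring
  have h₃ : cov[gridIncr B n i, gridMid B n (i + 1 + s)]
      = (cbrtStep i + (cbrtStep s + cbrtStep (s + 1)) / 2) / 2 * σ ^ 2 := by
    rw [covariance_gridMid hB _ _ mI, hr, show i + 1 + s + 1 = i + 1 + (s + 1) by ring, hr]
    ring
  have hanti := cbrtStep_antitone s.le_succ
  have hs1 := cbrtStep_antitone s.zero_le
  rw [cbrtStep_zero] at hs1
  have p0 := cbrtStep_nonneg i
  have p1 := cbrtStep_nonneg s
  have p2 := cbrtStep_nonneg (s + 1)
  have a₁ : |(cbrtStep (s + 1) - cbrtStep s) / 2| = (cbrtStep s - cbrtStep (s + 1)) / 2 := by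
    rw [abs_of_nonpos (by linarith)]
    ring
  have hG : HasGaussianLaw (fun ω => ![gridIncr B n i ω, gridIncr B n (i + 1 + s) ω,
      gridMid B n i ω, gridMid B n (i + 1 + s) ω]) volume := by
    have h := hB.hasGaussianLaw ![(i : ℝ) / n, (i + 1 : ℕ) / n, (i + 1 + s : ℕ) / n,
      (i + 1 + s + 1 : ℕ) / n] (by
        intro k
        fin_cases k <;> simp only [Fin.zero_eta, Fin.mk_one, Fin.reduceFinMk, Matrix.cons_val] <;>
          positivity)
    let e : Fin 4 → (Fin 4 → ℝ) →L[ℝ] ℝ := fun i => ContinuousLinearMap.proj i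
    let L : (Fin 4 → ℝ) →L[ℝ] (Fin 4 → ℝ) := ContinuousLinearMap.pi
      ![e 1 - e 0, e 3 - e 2, (1 / 2 : ℝ) • (e 0 + e 1), (1 / 2 : ℝ) • (e 2 + e 3)]
    suffices hL : (fun ω => ![gridIncr B n i ω, gridIncr B n (i + 1 + s) ω,
        gridMid B n i ω, gridMid B n (i + 1 + s) ω]) = L ∘ fun ω k => B (![(i : ℝ) / n,
          (i + 1 : ℕ) / n, (i + 1 + s : ℕ) / n, (i + 1 + s + 1 : ℕ) / n] k) ω by
      rw [hL]
      exact h.map L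
    funext ω k
    fin_cases k <;> simp [L, e, gridIncr, gridMid] <;> ring
  have hmain := abs_integral_pow_five_mul_le (hB.measurable_gridIncr n i)
    (hB.measurable_gridIncr n (i + 1 + s)) (hB.measurable_gridMid n i)
    (hB.measurable_gridMid n (i + 1 + s)) hG hσ0 (hB.map_gridIncr hσ i)
    (hB.map_gridIncr hσ (i + 1 + s)) h₁ h₂ h₃ (by rw [a₁]; linarith) hψK hψL
  refine hmain.trans ?_
  rw [a₁, abs_of_nonneg (by positivity), abs_of_nonneg (by positivity), quinticConst]
  have := absMoment_nonneg 10
  have := absMoment_nonneg 11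
  have q1 : 5 * 2 ^ 10 * absMoment 10 * K ^ 2 * σ ^ 10 * ((cbrtStep s - cbrtStep (s + 1)) / 2)
      ≤ 5 * 2 ^ 10 * absMoment 10 * K ^ 2 * σ ^ 10 * (cbrtStep s - cbrtStep (s + 1)) := by
    gcongr
    linarith
  have q2 : 2 ^ 11 * absMoment 11 * K ^ 2 * σ ^ 11 *
      (cbrtStep i / 2 + (cbrtStep i + (cbrtStep s + cbrtStep (s + 1)) / 2) / 2)
      ≤ 2 ^ 11 * absMoment 11 * K ^ 2 * σ ^ 11 * (cbrtStep i + cbrtStep s) := by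
    gcongr ?_ * ?_
    linarith
  have q3 : 0 ≤ 2 ^ 11 * absMoment 11 * K ^ 2 * σ ^ 10 * (cbrtStep s - cbrtStep (s + 1)) :=
    mul_nonneg (by positivity) (by linarith)
  have q4 : 0 ≤ 5 * 2 ^ 10 * absMoment 10 * K ^ 2 * σ ^ 11 * (cbrtStep i + cbrtStep s) := by
    positivity
  linarith

lemma IsFBM16.integral_gridTerm_sq_le (hB : IsFBM16 B) (hσ0 : 0 < σ)
    (hσ : σ ^ 2 * cbrt n = 1) (hψm : Measurable ψ) (hψK : ∀ x, |ψ x| ≤ K) (j : ℕ) :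
    MemLp (gridTerm ψ B n j) 2 volume ∧
      ∫ ω, gridTerm ψ B n j ω ^ 2 ≤ quinticConst K * σ ^ 10 := by
  have hm := hB.measurable_gridIncr n j
  have hmid := hB.measurable_gridMid n j
  have hmeas : Measurable (gridTerm ψ B n j) := by unfold gridTerm; fun_prop
  have hi := integrable_abs_pow_of_map_eq hm (hB.map_gridIncr hσ j) 10
  have hle : ∀ ω, gridTerm ψ B n j ω ^ 2 ≤ K ^ 2 * |gridIncr B n j ω| ^ 10 := fun ω => by
    rw [gridTerm, mul_pow, ← pow_mul, Even.pow_abs (by decide : Even 10), ← sq_abs (ψ _)]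
    exact mul_le_mul_of_nonneg_right (pow_le_pow_left₀ (abs_nonneg _) (hψK _) 2)
      (by rw [pow_mul]; positivity)
  have hsq : Integrable (fun ω => gridTerm ψ B n j ω ^ 2) volume :=
    (hi.const_mul (K ^ 2)).mono' (by fun_prop) (ae_of_all _ fun ω => by
      rw [Real.norm_of_nonneg (sq_nonneg _)]
      exact hle ω)
  refine ⟨(memLp_two_iff_integrable_sq hmeas.aestronglyMeasurable).2 hsq,
    (integral_mono hsq (hi.const_mul _) hle).trans ?_⟩
  rw [integral_const_mul, integral_abs_pow_of_map_eq hσ0.le hm (hB.map_gridIncr hσ j), quinticConst]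
  have := absMoment_nonneg 10
  have := absMoment_nonneg 11
  have q1 : 0 ≤ K ^ 2 * (σ ^ 10 * absMoment 10) := by positivity
  have q2 : 0 ≤ K ^ 2 * (σ ^ 10 * absMoment 11) := by positivity
  linarith

lemma IsFBM16.integral_sum_gridTerm_sq_le (hB : IsFBM16 B) (hσ0 : 0 < σ)
    (hσ : σ ^ 2 * cbrt n = 1) (hψK : ∀ x, |ψ x| ≤ K)
    (hψL : ∀ x y, |ψ x - ψ y| ≤ K * |x - y|) (k : ℕ) :
    ∫ ω, (∑ j ∈ Finset.range k, gridTerm ψ B n j ω) ^ 2 ≤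
      k * (quinticConst K * (3 * σ ^ 10 + 4 * σ ^ 11 * cbrt k)) := by
  have hK : 0 ≤ K := (abs_nonneg _).trans (hψK 0)
  have hψm : Measurable ψ :=
    (LipschitzWith.of_dist_le_mul (K := ⟨K, hK⟩) fun x y => hψL x y).continuous.measurable
  have hterm := hB.integral_gridTerm_sq_le hσ0 hσ hψm hψK
  have hQ := quinticConst_nonneg K
  induction k with
  | zero => simp
  | succ k ih =>
    have hprod : ∀ j, Integrable (fun ω => gridTerm ψ B n j ω * gridTerm ψ B n k ω) volume :=
      fun j => (hterm j).1.integrable_mul (hterm k).1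
    have hcross : ∫ ω, (∑ j ∈ Finset.range k, gridTerm ψ B n j ω) * gridTerm ψ B n k ω
        ≤ quinticConst K * (σ ^ 10 + 2 * σ ^ 11 * cbrt k) := by
      simp_rw [Finset.sum_mul]
      rw [integral_finsetSum _ fun j _ => hprod j]
      calc _ ≤ ∑ j ∈ Finset.range k, quinticConst K * (σ ^ 10 *
            (cbrtStep (k - 1 - j) - cbrtStep (k - 1 - j + 1))
            + σ ^ 11 * (cbrtStep j + cbrtStep (k - 1 - j))) := by
            refine Finset.sum_le_sum fun j hj => (le_abs_self _).trans ?_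
            have hjk : j < k := Finset.mem_range.1 hj
            have h := hB.abs_integral_gridTerm_mul_le hσ0 hσ hψK hψL j (k - 1 - j)
            rwa [show j + 1 + (k - 1 - j) = k by omega] at h
        _ = quinticConst K * (σ ^ 10 * (1 - cbrtStep k) + 2 * σ ^ 11 * cbrt k) := by
            rw [← Finset.mul_sum, Finset.sum_add_distrib, ← Finset.mul_sum, ← Finset.mul_sum,
              Finset.sum_add_distrib,
              Finset.sum_range_reflect (fun s => cbrtStep s - cbrtStep (s + 1)),
              Finset.sum_range_reflect cbrtStep, sum_cbrtStep, Finset.sum_range_sub', cbrtStep_zero]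
            ring
        _ ≤ _ := by
            gcongr
            nlinarith [cbrtStep_nonneg k, pow_pos hσ0 10]
    have hS : MemLp (fun ω => ∑ j ∈ Finset.range k, gridTerm ψ B n j ω) 2 volume :=
      memLp_finsetSum _ fun j _ => (hterm j).1
    have hSk : Integrable (fun ω =>
        2 * ((∑ j ∈ Finset.range k, gridTerm ψ B n j ω) * gridTerm ψ B n k ω)) volume :=
      (hS.integrable_mul (hterm k).1).const_mul 2
    have hmono : cbrt k ≤ cbrt (k + 1) := cbrt_mono k.le_succ
    have hc0 : 0 ≤ cbrt k := Real.rpow_nonneg k.cast_nonneg _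
    calc ∫ ω, (∑ j ∈ Finset.range (k + 1), gridTerm ψ B n j ω) ^ 2
        = ∫ ω, ((∑ j ∈ Finset.range k, gridTerm ψ B n j ω) ^ 2
          + 2 * ((∑ j ∈ Finset.range k, gridTerm ψ B n j ω) * gridTerm ψ B n k ω)
          + gridTerm ψ B n k ω ^ 2) := by
          congr 1
          funext ω
          rw [Finset.sum_range_succ]
          ring
      _ = (∫ ω, (∑ j ∈ Finset.range k, gridTerm ψ B n j ω) ^ 2)
          + 2 * (∫ ω, (∑ j ∈ Finset.range k, gridTerm ψ B n j ω) * gridTerm ψ B n k ω)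
          + ∫ ω, gridTerm ψ B n k ω ^ 2 := by
          rw [integral_add (by exact hS.integrable_sq.add hSk) (hterm k).1.integrable_sq,
            integral_add hS.integrable_sq hSk, integral_const_mul]
      _ ≤ k * (quinticConst K * (3 * σ ^ 10 + 4 * σ ^ 11 * cbrt k))
          + 2 * (quinticConst K * (σ ^ 10 + 2 * σ ^ 11 * cbrt k))
          + quinticConst K * σ ^ 10 := by
          gcongr
          exact (hterm k).2
      _ = (k + 1 : ℕ) * (quinticConst K * (3 * σ ^ 10 + 4 * σ ^ 11 * cbrt k)) := by
          push_cast
          ring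
      _ ≤ _ := by gcongr

end Grid

section Maximal

variable {Ω : Type*} [MeasurableSpace Ω] {P : Measure Ω}

lemma measureReal_le_abs_le {X : Ω → ℝ} (hX : MemLp X 2 P) {δ : ℝ} (hδ : 0 < δ) :
    P.real {ω | δ ≤ |X ω|} ≤ (∫ ω, X ω ^ 2 ∂P) / δ ^ 2 := by
  have h := mul_meas_ge_le_integral_of_nonneg (ae_of_all P fun ω => sq_nonneg (X ω))
    hX.integrable_sq (δ ^ 2)
  have hset : {ω | δ ≤ |X ω|} = {ω | δ ^ 2 ≤ X ω ^ 2} := by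
    simp_rw [sq_le_sq, abs_of_pos hδ]
  rwa [le_div_iff₀ (by positivity), mul_comm, hset]

/-- A maximal inequality for partial sums, obtained by cutting the sum into blocks of length `m`. -/
lemma measureReal_exists_partial_sum_le [IsFiniteMeasure P] {W : ℕ → Ω → ℝ} {a b δ : ℝ} {N m : ℕ} (hm : 0 < m)
    (hδ : 0 < δ) (hW : ∀ j, MemLp (W j) 2 P)
    (ha : ∀ k ≤ N, ∫ ω, (∑ j ∈ Finset.range k, W j ω) ^ 2 ∂P ≤ a)
    (hb : ∀ j, ∫ ω, W j ω ^ 2 ∂P ≤ b) :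
    P.real {ω | ∃ k ≤ N, 2 * δ ≤ |∑ j ∈ Finset.range k, W j ω|} ≤
      ((N / m : ℕ) + 1) * ((a + m ^ 2 * b) / δ ^ 2) := by
  set S : ℕ → Ω → ℝ := fun k ω => ∑ j ∈ Finset.range k, W j ω with hS
  set A : ℕ → Ω → ℝ := fun q ω => ∑ j ∈ Finset.range m, |W (m * q + j) ω| with hA
  have mS : ∀ k, MemLp (S k) 2 P := fun k => memLp_finsetSum _ fun j _ => hW j
  have mA : ∀ q, MemLp (A q) 2 P := fun q => memLp_finsetSum _ fun j _ => (hW _).abs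
  have hAle : ∀ q, ∫ ω, A q ω ^ 2 ∂P ≤ m ^ 2 * b := fun q => by
    have hi : ∀ j, Integrable (fun ω => W (m * q + j) ω ^ 2) P := fun j => (hW _).integrable_sq
    calc ∫ ω, A q ω ^ 2 ∂P ≤ ∫ ω, m * ∑ j ∈ Finset.range m, W (m * q + j) ω ^ 2 ∂P := by
          refine integral_mono (mA q).integrable_sq
            ((integrable_finsetSum _ fun j _ => hi j).const_mul _) fun ω => ?_
          simpa using sq_sum_le_card_mul_sum_sq (s := Finset.range m)
            (f := fun j => |W (m * q + j) ω|)
      _ = m * ∑ j ∈ Finset.range m, ∫ ω, W (m * q + j) ω ^ 2 ∂P := by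
          rw [integral_const_mul, integral_finsetSum _ fun j _ => hi j]
      _ ≤ m * ∑ j ∈ Finset.range m, b := by
          gcongr
          exact hb _
      _ = m ^ 2 * b := by
          simp
          ring
  have hsub : {ω | ∃ k ≤ N, 2 * δ ≤ |S k ω|} ⊆
      ⋃ q ∈ Finset.range (N / m + 1), ({ω | δ ≤ |S (m * q) ω|} ∪ {ω | δ ≤ |A q ω|}) := by
    rintro ω ⟨k, hk, hkS⟩
    have hq : k / m < N / m + 1 := Nat.lt_succ_of_le (Nat.div_le_div_right hk)
    simp only [Set.mem_iUnion, Finset.mem_range]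
    refine ⟨k / m, hq, ?_⟩
    by_contra! hcon
    simp only [Set.mem_union, Set.mem_ofPred_eq, not_or, not_le] at hcon
    have hsplit : S k ω = S (m * (k / m)) ω
        + ∑ j ∈ Finset.range (k % m), W (m * (k / m) + j) ω := by
      conv_lhs => rw [← Nat.div_add_mod k m]
      exact Finset.sum_range_add _ _ _
    have hrest : |∑ j ∈ Finset.range (k % m), W (m * (k / m) + j) ω| ≤ A (k / m) ω :=
      (Finset.abs_sum_le_sum_abs _ _).trans
        (Finset.sum_le_sum_of_subset_of_nonneg
          (Finset.range_mono (Nat.mod_lt k hm).le) fun _ _ _ => abs_nonneg _)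
    rw [hsplit] at hkS
    have := abs_add_le (S (m * (k / m)) ω) (∑ j ∈ Finset.range (k % m), W (m * (k / m) + j) ω)
    linarith [le_abs_self (A (k / m) ω)]
  calc P.real {ω | ∃ k ≤ N, 2 * δ ≤ |S k ω|}
      ≤ ∑ q ∈ Finset.range (N / m + 1), P.real ({ω | δ ≤ |S (m * q) ω|} ∪ {ω | δ ≤ |A q ω|}) :=
        (measureReal_mono hsub (measure_ne_top _ _)).trans (measureReal_biUnion_finset_le _ _)
    _ ≤ ∑ q ∈ Finset.range (N / m + 1), (a + m ^ 2 * b) / δ ^ 2 := by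
        refine Finset.sum_le_sum fun q hq => (measureReal_union_le _ _).trans ?_
        have hqN : m * q ≤ N := (Nat.mul_le_mul_left m
          (Nat.lt_succ_iff.1 (Finset.mem_range.1 hq))).trans (Nat.mul_div_le N m)
        rw [add_div]
        gcongr
        · exact (measureReal_le_abs_le (mS _) hδ).trans (by gcongr; exact ha _ hqN)
        · exact (measureReal_le_abs_le (mA _) hδ).trans (by gcongr; exact hAle _)
    _ = _ := by
        rw [Finset.sum_const, Finset.card_range, nsmul_eq_mul]
        push_cast
        ring

end Maximal

section Rate

/-- The mesh rate `n ^ (-1 / 12)`, the square root of the standard deviation of an increment. -/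
def meshRate (n : ℕ) : ℝ := (n : ℝ) ^ (-((1 : ℝ) / 12))

lemma tendsto_meshRate : Tendsto meshRate atTop (𝓝 0) :=
  (tendsto_rpow_neg_atTop (by norm_num)).comp tendsto_natCast_atTop_atTop

variable {n : ℕ}

lemma meshRate_pos (hn : 0 < n) : 0 < meshRate n := Real.rpow_pos_of_pos (by exact_mod_cast hn) _

lemma meshRate_le_one (hn : 0 < n) : meshRate n ≤ 1 :=
  Real.rpow_le_one_of_one_le_of_nonpos (by exact_mod_cast hn) (by norm_num)

lemma natCast_mul_meshRate_pow (hn : 0 < n) : n * meshRate n ^ 12 = 1 := by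
  have h : (0 : ℝ) < n := by exact_mod_cast hn
  rw [meshRate, ← Real.rpow_natCast, ← Real.rpow_mul h.le]
  norm_num
  rw [Real.rpow_neg_one, mul_inv_cancel₀ h.ne']

lemma meshRate_pow_mul_cbrt (hn : 0 < n) : (meshRate n ^ 2) ^ 2 * cbrt n = 1 := by
  have h : (0 : ℝ) < n := by exact_mod_cast hn
  rw [← pow_mul, meshRate, cbrt, ← Real.rpow_natCast, ← Real.rpow_mul h.le, ← Real.rpow_add h]
  norm_num

variable {T : ℝ}

lemma floor_mul_meshRate_pow_le (hT : 0 < T) (hn : 0 < n) :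
    ⌊n * T⌋₊ * meshRate n ^ 12 ≤ T := by
  have hy := meshRate_pos hn
  calc (⌊n * T⌋₊ : ℝ) * meshRate n ^ 12 ≤ n * T * meshRate n ^ 12 := by
        gcongr
        exact Nat.floor_le (by positivity)
    _ = n * meshRate n ^ 12 * T := by ring
    _ = T := by rw [natCast_mul_meshRate_pow hn, one_mul]

lemma cbrt_floor_mul_meshRate_pow_le (hT : 0 < T) (hn : 0 < n) :
    cbrt ⌊n * T⌋₊ * meshRate n ^ 4 ≤ T + 1 := by
  have hy := meshRate_pos hn
  have h1 : cbrt ⌊n * T⌋₊ ≤ cbrt n * (T + 1) := by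
    calc cbrt ⌊n * T⌋₊ ≤ (n * (T + 1)) ^ ((1 : ℝ) / 3) := by
          refine Real.rpow_le_rpow (by positivity) ?_ (by norm_num)
          exact (Nat.floor_le (by positivity)).trans (by gcongr; linarith)
      _ = cbrt n * (T + 1) ^ ((1 : ℝ) / 3) := Real.mul_rpow (by positivity) (by positivity)
      _ ≤ cbrt n * (T + 1) ^ (1 : ℝ) := by
          have : 0 ≤ cbrt n := Real.rpow_nonneg n.cast_nonneg _
          gcongr
          · linarith
          · norm_num
      _ = _ := by rw [Real.rpow_one]
  calc _ ≤ cbrt n * (T + 1) * meshRate n ^ 4 := by gcongr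
    _ = ((meshRate n ^ 2) ^ 2 * cbrt n) * (T + 1) := by ring
    _ = T + 1 := by rw [meshRate_pow_mul_cbrt hn, one_mul]

lemma exists_block_length (hT : 0 < T) (hn : 0 < n) :
    ∃ m : ℕ, 0 < m ∧ m * meshRate n ^ 7 ≤ 2 ∧
      (((⌊n * T⌋₊ / m : ℕ) : ℝ) + 1) * meshRate n ^ 5 ≤ T + 1 := by
  have hy := meshRate_pos hn
  have hy1 := meshRate_le_one hn
  have hp5 : meshRate n ^ 5 ≤ 1 := pow_le_one₀ hy.le hy1
  have hp7 : meshRate n ^ 7 ≤ 1 := pow_le_one₀ hy.le hy1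
  have hy7 : 0 < meshRate n ^ 7 := by positivity
  set m := ⌈(meshRate n ^ 7)⁻¹⌉₊ with hm
  have hm0 : 0 < m := Nat.ceil_pos.2 (by positivity)
  have hm0' : (0 : ℝ) < m := by exact_mod_cast hm0
  have hge : 1 ≤ m * meshRate n ^ 7 := by
    rw [← div_le_iff₀ hy7, one_div]
    exact Nat.le_ceil _
  have hle : m * meshRate n ^ 7 ≤ 2 := by
    have h := (Nat.ceil_lt_add_one (inv_nonneg.2 hy7.le)).le
    calc _ ≤ ((meshRate n ^ 7)⁻¹ + 1) * meshRate n ^ 7 := by gcongr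
      _ = 1 + meshRate n ^ 7 := by rw [add_mul, inv_mul_cancel₀ hy7.ne', one_mul]
      _ ≤ 2 := by linarith
  refine ⟨m, hm0, hle, ?_⟩
  have hdiv : ((⌊n * T⌋₊ / m : ℕ) : ℝ) * meshRate n ^ 5 ≤ T := by
    calc _ ≤ (⌊n * T⌋₊ / m : ℝ) * meshRate n ^ 5 := by
          gcongr
          exact Nat.cast_div_le
      _ ≤ (⌊n * T⌋₊ / m : ℝ) * meshRate n ^ 5 * (m * meshRate n ^ 7) :=
          le_mul_of_one_le_right (by positivity) hge
      _ = ⌊n * T⌋₊ * meshRate n ^ 12 := by field_simp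
      _ ≤ T := floor_mul_meshRate_pow_le hT hn
  linarith

variable {Ω : Type*} [MeasureSpace Ω] [IsProbabilityMeasure (volume : Measure Ω)]
  {B : ℝ → Ω → ℝ} {K : ℝ} {ψ : ℝ → ℝ}

lemma IsFBM16.measureReal_exists_sum_gridTerm_le (hB : IsFBM16 B) (hψK : ∀ x, |ψ x| ≤ K)
    (hψL : ∀ x y, |ψ x - ψ y| ≤ K * |x - y|) {δ : ℝ} (hδ : 0 < δ) (hT : 0 < T) (hn : 0 < n) :
    volume.real {ω | ∃ k ≤ ⌊n * T⌋₊, 2 * δ ≤ |∑ j ∈ Finset.range k, gridTerm ψ B n j ω|} ≤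
      (T + 1) * (quinticConst K * (3 * (T + 1) + 4 * (T + 1) ^ 2 + 4) / δ ^ 2) * meshRate n := by
  have hK : 0 ≤ K := (abs_nonneg _).trans (hψK 0)
  have hψm : Measurable ψ :=
    (LipschitzWith.of_dist_le_mul (K := ⟨K, hK⟩) fun x y => hψL x y).continuous.measurable
  have hQ := quinticConst_nonneg K
  have hN := floor_mul_meshRate_pow_le hT hn
  have hc := cbrt_floor_mul_meshRate_pow_le hT hn
  have hy := meshRate_pos hn
  have hy1 := meshRate_le_one hn
  obtain ⟨m, hm, hm2, hblock⟩ := exists_block_length hT hn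
  have hσ := meshRate_pow_mul_cbrt hn
  set y := meshRate n with hy_def
  set N := ⌊n * T⌋₊ with hN_def
  have hc0 : ∀ k, 0 ≤ cbrt k := fun k => Real.rpow_nonneg k.cast_nonneg _
  have hσ0 : 0 < y ^ 2 := by positivity
  have hterm := hB.integral_gridTerm_sq_le hσ0 hσ hψm hψK
  refine (measureReal_exists_partial_sum_le (m := m)
    (a := N * (quinticConst K * (3 * (y ^ 2) ^ 10 + 4 * (y ^ 2) ^ 11 * cbrt N)))
    hm hδ (fun j => (hterm j).1) (fun k hk => ?_) fun j => (hterm j).2).trans ?_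
  · refine (hB.integral_sum_gridTerm_sq_le hσ0 hσ hψK hψL k).trans ?_
    have := cbrt_mono hk
    have := hc0 k
    gcongr
  · have h8 : y ^ 8 ≤ y ^ 6 := pow_le_pow_of_le_one hy.le hy1 (by norm_num)
    have ha : N * (quinticConst K * (3 * (y ^ 2) ^ 10 + 4 * (y ^ 2) ^ 11 * cbrt N))
        + m ^ 2 * (quinticConst K * (y ^ 2) ^ 10)
        ≤ quinticConst K * (3 * (T + 1) + 4 * (T + 1) ^ 2 + 4) * y ^ 6 := by
      calc _ = quinticConst K * (3 * (N * y ^ 12) * y ^ 8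
            + 4 * ((N * y ^ 12) * (cbrt N * y ^ 4)) * y ^ 6 + (m * y ^ 7) ^ 2 * y ^ 6) := by ring
        _ ≤ quinticConst K * (3 * (T + 1) * y ^ 6
            + 4 * ((T + 1) * (T + 1)) * y ^ 6 + 2 ^ 2 * y ^ 6) := by
            have := hc0 N
            gcongr <;> linarith
        _ = _ := by ring
    calc _ ≤ (((N / m : ℕ) : ℝ) + 1)
          * (quinticConst K * (3 * (T + 1) + 4 * (T + 1) ^ 2 + 4) * y ^ 6 / δ ^ 2) := by gcongr
      _ = ((((N / m : ℕ) : ℝ) + 1) * y ^ 5)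
          * (quinticConst K * (3 * (T + 1) + 4 * (T + 1) ^ 2 + 4) / δ ^ 2) * y := by ring
      _ ≤ _ := by gcongr

lemma IsFBM16.integral_sum_abs_gridIncr_pow_seven_le (hB : IsFBM16 B) (hT : 0 < T) (hn : 0 < n) :
    Integrable (fun ω => ∑ j ∈ Finset.range ⌊n * T⌋₊, |gridIncr B n j ω| ^ 7) volume ∧
    ∫ ω, ∑ j ∈ Finset.range ⌊n * T⌋₊, |gridIncr B n j ω| ^ 7 ≤
      T * absMoment 7 * meshRate n := by
  have hσ := meshRate_pow_mul_cbrt hn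
  have hy := meshRate_pos hn
  have hi : ∀ j, Integrable (fun ω => |gridIncr B n j ω| ^ 7) volume := fun j =>
    integrable_abs_pow_of_map_eq (hB.measurable_gridIncr n j) (hB.map_gridIncr hσ j) 7
  refine ⟨integrable_finsetSum _ fun j _ => hi j, ?_⟩
  rw [integral_finsetSum _ fun j _ => hi j]
  simp_rw [fun j => integral_abs_pow_of_map_eq (sq_nonneg (meshRate n))
    (hB.measurable_gridIncr n j) (hB.map_gridIncr hσ j) 7]
  rw [Finset.sum_const, Finset.card_range, nsmul_eq_mul]
  have hN := floor_mul_meshRate_pow_le hT hn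
  have h7 := absMoment_nonneg 7
  have hy2 : meshRate n ^ 2 ≤ meshRate n := by nlinarith [meshRate_le_one hn]
  calc _ = (⌊n * T⌋₊ * meshRate n ^ 12) * absMoment 7 * meshRate n ^ 2 := by ring
    _ ≤ _ := by gcongr

end Rate

section Localization

lemma contDiff_iteratedDeriv_of_smooth {f : ℝ → ℝ} (hf : ContDiff ℝ (⊤ : ℕ∞) f) (k : ℕ) :
    ContDiff ℝ (⊤ : ℕ∞) (iteratedDeriv k f) := by
  rw [iteratedDeriv_eq_iterate]
  exact hf.iterate_deriv k

lemma contDiff_quinticWeight {f g h : ℝ → ℝ} (hf : ContDiff ℝ (⊤ : ℕ∞) f)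
    (hg : ContDiff ℝ (⊤ : ℕ∞) g) (hh : ContDiff ℝ (⊤ : ℕ∞) h) :
    ContDiff ℝ (⊤ : ℕ∞) (quinticWeight f g h) := by
  have key : ∀ u : ℝ → ℝ, ContDiff ℝ (⊤ : ℕ∞) u →
      ContDiff ℝ (⊤ : ℕ∞) (deriv u) ∧ ContDiff ℝ (⊤ : ℕ∞) (iteratedDeriv 3 u) := fun u hu =>
    ⟨iteratedDeriv_one (f := u) ▸ contDiff_iteratedDeriv_of_smooth hu 1,
      contDiff_iteratedDeriv_of_smooth hu 3⟩
  obtain ⟨f1, f3⟩ := key f hf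
  obtain ⟨g1, g3⟩ := key g hg
  obtain ⟨h1, h3⟩ := key h hh
  exact ((((f3.mul g1).mul h1).add ((f1.mul g3).mul h1)).add ((f1.mul g1).mul h3)).div_const 24

/-- A smooth function agrees on a bounded interval with a bounded Lipschitz function. -/
lemma exists_bounded_lipschitz_extension {ψ : ℝ → ℝ} (hψ : ContDiff ℝ (⊤ : ℕ∞) ψ) {M : ℝ}
    (hM : 0 ≤ M) : ∃ (φ : ℝ → ℝ) (K : ℝ), (∀ x, |φ x| ≤ K) ∧
      (∀ x y, |φ x - φ y| ≤ K * |x - y|) ∧ ∀ x, |x| ≤ M → φ x = ψ x := by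
  obtain ⟨K0, -, hK0⟩ := exists_abs_le_of_continuous hψ.continuous M
  obtain ⟨K1, hK10, hK1⟩ :=
    exists_abs_le_of_continuous (hψ.continuous_deriv (by exact_mod_cast le_top)) M
  let c : ℝ → ℝ := fun x => Set.projIcc (-M) M (by linarith) x
  have hc : ∀ x, |c x| ≤ M := fun x => abs_le.2 (Set.projIcc (-M) M (by linarith) x).2
  have hcL : ∀ x y, |c x - c y| ≤ |x - y| := fun x y => by
    have h := (LipschitzWith.projIcc (show -M ≤ M by linarith)).dist_le_mul x y
    rwa [NNReal.coe_one, one_mul] at h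
  refine ⟨fun x => ψ (c x), max K0 K1, fun x => (hK0 _ (hc x)).trans (le_max_left _ _),
    fun x y => ?_, fun x hx => ?_⟩
  · have h := (convex_Icc (-M) M).norm_image_sub_le_of_norm_deriv_le (f := ψ) (C := K1)
      (fun x _ => hψ.differentiable (by simp) x) (fun x hx => hK1 x (abs_le.2 hx))
      (abs_le.1 (hc y)) (abs_le.1 (hc x))
    calc _ ≤ K1 * |c x - c y| := h
      _ ≤ max K0 K1 * |x - y| := by
        exact mul_le_mul (le_max_right _ _) (hcL x y) (abs_nonneg _) (hK10.trans (le_max_right _ _))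
  · simp only [c, Set.projIcc_of_mem (show -M ≤ M by linarith) (abs_le.1 hx)]

variable {Ω : Type*} [MeasureSpace Ω] [IsProbabilityMeasure (volume : Measure Ω)]
  {B : ℝ → Ω → ℝ}

lemma IsFBM16.exists_bounded_paths (hB : IsFBM16 B) (T : ℝ) {η : ℝ} (hη : 0 < η) :
    ∃ (M : ℝ) (s : Set Ω), 0 ≤ M ∧ volume.real s < η ∧
      ∀ ω ∉ s, ∀ q : ℚ, 0 ≤ (q : ℝ) → (q : ℝ) ≤ T → |B q ω| ≤ M := by
  let s : ℕ → Set Ω := fun M => ⋃ q : {q : ℚ // 0 ≤ (q : ℝ) ∧ (q : ℝ) ≤ T}, {ω | M < |B q ω|}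
  have hs : ∀ M, MeasurableSet (s M) := fun M =>
    MeasurableSet.iUnion fun q => measurableSet_lt measurable_const (hB.1 q).abs
  have hanti : Antitone s := fun M M' hMM' => Set.iUnion_mono fun q ω hω => by
    have : (M : ℝ) ≤ M' := by exact_mod_cast hMM'
    exact this.trans_lt hω
  have hempty : ⋂ M, s M = ∅ := by
    refine Set.eq_empty_of_forall_notMem fun ω hω => ?_
    obtain ⟨C, hC⟩ := isCompact_Icc.exists_bound_of_continuousOn
      (hB.2.1 ω).continuousOn (s := Set.Icc 0 T)
    obtain ⟨M, hM⟩ := exists_nat_ge C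
    obtain ⟨q, hq⟩ := Set.mem_iUnion.1 (Set.mem_iInter.1 hω M)
    exact absurd (hC q q.2) (not_le.2 (hM.trans_lt hq))
  have hlim := tendsto_measure_iInter_atTop (μ := volume) (fun M => (hs M).nullMeasurableSet)
    hanti ⟨0, measure_ne_top _ _⟩
  rw [hempty, measure_empty] at hlim
  have hlim' := (ENNReal.tendsto_toReal_zero_iff fun M => measure_ne_top volume (s M)).2 hlim
  obtain ⟨M, hM⟩ := (hlim'.eventually_lt_const hη).exists
  refine ⟨M, s M, M.cast_nonneg, hM, fun ω hω q h0 hT => ?_⟩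
  by_contra! hcon
  exact hω (Set.mem_iUnion.2 ⟨⟨q, h0, hT⟩, hcon⟩)

end Localization

section Conclusion

lemma sum_Icc_one_eq_sum_range (F : ℕ → ℝ) (k : ℕ) :
    ∑ j ∈ Finset.Icc 1 k, F j = ∑ j ∈ Finset.range k, F (j + 1) := by
  induction k with
  | zero => simp
  | succ k ih => rw [Finset.sum_Icc_succ_top (by omega), ih, Finset.sum_range_succ]

variable {Ω : Type*} {B : ℝ → Ω → ℝ}

/-- The difference between a triple product of increments and its third-order approximation. -/
def gridError (f g h : ℝ → ℝ) (B : ℝ → Ω → ℝ) (n j : ℕ) (ω : Ω) : ℝ :=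
  (f (B ((j + 1 : ℕ) / n) ω) - f (B (j / n) ω)) * (g (B ((j + 1 : ℕ) / n) ω) - g (B (j / n) ω)) *
    (h (B ((j + 1 : ℕ) / n) ω) - h (B (j / n) ω))
  - deriv f (gridMid B n j ω) * deriv g (gridMid B n j ω) * deriv h (gridMid B n j ω)
    * gridIncr B n j ω ^ 3

variable {f g h φ : ℝ → ℝ} {C M T : ℝ} {n : ℕ} {ω : Ω}

lemma abs_sum_gridError_le (hC : 0 ≤ C)
    (hexp : ∀ a b, |a| ≤ M → |b| ≤ M →
      |(f b - f a) * (g b - g a) * (h b - h a)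
        - deriv f ((a + b) / 2) * deriv g ((a + b) / 2) * deriv h ((a + b) / 2) * (b - a) ^ 3
        - quinticWeight f g h ((a + b) / 2) * (b - a) ^ 5| ≤ C * |b - a| ^ 7)
    (hφ : ∀ x, |x| ≤ M → φ x = quinticWeight f g h x) (hT : 0 < T) (hn : 0 < n)
    (hω : ∀ q : ℚ, 0 ≤ (q : ℝ) → (q : ℝ) ≤ T → |B q ω| ≤ M) {k : ℕ} (hk : k ≤ ⌊n * T⌋₊) :
    |∑ j ∈ Finset.range k, gridError f g h B n j ω| ≤
      |∑ j ∈ Finset.range k, gridTerm φ B n j ω|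
        + C * ∑ j ∈ Finset.range ⌊n * T⌋₊, |gridIncr B n j ω| ^ 7 := by
  have hn' : (0 : ℝ) < n := by exact_mod_cast hn
  have hgrid : ∀ j ≤ ⌊n * T⌋₊, |B ((j : ℝ) / n) ω| ≤ M := fun j hj => by
    have h := hω ((j : ℚ) / n)
    push_cast at h
    refine h (by positivity) ?_
    rw [div_le_iff₀ hn', mul_comm]
    exact (Nat.le_floor_iff (by positivity)).1 hj
  have hterm : ∀ j ∈ Finset.range k,
      |gridError f g h B n j ω - gridTerm φ B n j ω| ≤ C * |gridIncr B n j ω| ^ 7 := fun j hj => by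
    have hjk := Finset.mem_range.1 hj
    have ha := hgrid j (by omega)
    have hb := hgrid (j + 1) (by omega)
    have hmid : |gridMid B n j ω| ≤ M := by
      rw [gridMid]
      rw [abs_le] at *
      constructor <;> linarith
    rw [gridTerm, hφ _ hmid]
    exact hexp _ _ ha hb
  have hsum : |∑ j ∈ Finset.range k, gridError f g h B n j ω
      - ∑ j ∈ Finset.range k, gridTerm φ B n j ω|
      ≤ C * ∑ j ∈ Finset.range ⌊n * T⌋₊, |gridIncr B n j ω| ^ 7 := by
    rw [← Finset.sum_sub_distrib, Finset.mul_sum]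
    refine (Finset.abs_sum_le_sum_abs _ _).trans ((Finset.sum_le_sum hterm).trans ?_)
    exact Finset.sum_le_sum_of_subset_of_nonneg (Finset.range_mono hk)
      fun _ _ _ => by positivity
  have := abs_add_le (∑ j ∈ Finset.range k, gridTerm φ B n j ω)
    (∑ j ∈ Finset.range k, gridError f g h B n j ω - ∑ j ∈ Finset.range k, gridTerm φ B n j ω)
  rw [add_sub_cancel] at this
  linarith

end Conclusion

/-- The weak triple covariation of `X = f(B)`, `Y = g(B)`, `Z = h(B)` equals
`∫ (f'g'h')(B) d⟦B⟧` at the level of Riemann-sum representatives. -/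
theorem stmt17 {Ω : Type*} [MeasureSpace Ω] [IsProbabilityMeasure (volume : Measure Ω)]
    (B : ℝ → Ω → ℝ) (hB : IsFBM16 B)
    (f g h : ℝ → ℝ) (hf : ContDiff ℝ (⊤ : ℕ∞) f) (hg : ContDiff ℝ (⊤ : ℕ∞) g) (hh : ContDiff ℝ (⊤ : ℕ∞) h) :
    ∀ T > (0 : ℝ), ∀ ε > (0 : ℝ),
      Tendsto (fun n : ℕ =>
          volume {ω : Ω | ε ≤
            ⨆ t ∈ Set.Icc (0 : ℝ) T,
              |(∑ j ∈ Finset.Icc 1 ⌊(n : ℝ) * t⌋₊,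
                  (f (B ((j : ℝ) / n) ω) - f (B (((j : ℝ) - 1) / n) ω)) *
                    (g (B ((j : ℝ) / n) ω) - g (B (((j : ℝ) - 1) / n) ω)) *
                    (h (B ((j : ℝ) / n) ω) - h (B (((j : ℝ) - 1) / n) ω)))
                - ∑ j ∈ Finset.Icc 1 ⌊(n : ℝ) * t⌋₊,
                    (deriv f ((B (((j : ℝ) - 1) / n) ω + B ((j : ℝ) / n) ω) / 2) *
                      deriv g ((B (((j : ℝ) - 1) / n) ω + B ((j : ℝ) / n) ω) / 2) *
                      deriv h ((B (((j : ℝ) - 1) / n) ω + B ((j : ℝ) / n) ω) / 2)) *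
                    (B ((j : ℝ) / n) ω - B (((j : ℝ) - 1) / n) ω) ^ 3|})
        atTop (𝓝 0) := by
  intro T hT ε hε
  rw [← ENNReal.tendsto_toReal_zero_iff fun n => measure_ne_top _ _]
  refine tendsto_order.2 ⟨fun a ha => Eventually.of_forall fun n => ha.trans_le measureReal_nonneg,
    fun η hη => ?_⟩
  obtain ⟨M, s, hM, hs, hpath⟩ := hB.exists_bounded_paths T (half_pos hη)
  obtain ⟨C, hC, hexp⟩ := exists_triple_product_expansion hf hg hh M
  obtain ⟨φ, K, hφK, hφL, hφ⟩ :=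
    exists_bounded_lipschitz_extension (contDiff_quinticWeight hf hg hh) hM
  set c₁ := (T + 1) * (quinticConst K * (3 * (T + 1) + 4 * (T + 1) ^ 2 + 4) / (ε / 8) ^ 2)
  set c₂ := C * (T * absMoment 7) / (ε / 4)
  have hlim : Tendsto (fun n => (c₁ + c₂) * meshRate n) atTop (𝓝 0) := by
    simpa using tendsto_meshRate.const_mul (c₁ + c₂)
  filter_upwards [hlim.eventually_lt_const (half_pos hη), eventually_gt_atTop 0] with n hrate hn
  set S₁ := {ω | ∃ k ≤ ⌊n * T⌋₊, 2 * (ε / 8) ≤ |∑ j ∈ Finset.range k, gridTerm φ B n j ω|}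
  set S₂ := {ω | ε / 4 ≤ C * ∑ j ∈ Finset.range ⌊n * T⌋₊, |gridIncr B n j ω| ^ 7}
  have hS₁ : volume.real S₁ ≤ c₁ * meshRate n :=
    hB.measureReal_exists_sum_gridTerm_le hφK hφL (by positivity) hT hn
  have hS₂ : volume.real S₂ ≤ c₂ * meshRate n := by
    obtain ⟨hi, hle⟩ := hB.integral_sum_abs_gridIncr_pow_seven_le hT hn
    have hmarkov := mul_meas_ge_le_integral_of_nonneg (μ := volume)
      (ae_of_all _ fun ω => by positivity) (hi.const_mul C) (ε / 4)
    rw [integral_const_mul] at hmarkov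
    rw [div_mul_eq_mul_div, le_div_iff₀ (by positivity), mul_comm, mul_assoc]
    exact hmarkov.trans (by gcongr)
  have hcover := measureReal_union_le (μ := volume) S₁ S₂
  have hcover' := measureReal_union_le (μ := volume) s (S₁ ∪ S₂)
  rw [add_mul] at hrate
  refine lt_of_le_of_lt (measureReal_mono (s₂ := s ∪ (S₁ ∪ S₂)) ?_ (measure_ne_top _ _)) (by linarith)
  intro ω hω
  by_contra hcon
  simp only [Set.mem_union, not_or] at hcon
  obtain ⟨hωs, hω₁, hω₂⟩ := hcon
  have hω₁' : ∀ k ≤ ⌊n * T⌋₊, |∑ j ∈ Finset.range k, gridTerm φ B n j ω| < 2 * (ε / 8) :=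
    fun k hk => not_le.1 fun hle => hω₁ ⟨k, hk, hle⟩
  have hω₂' : _ < _ := not_le.1 (show ¬ε / 4 ≤ _ from hω₂)
  refine absurd (Set.mem_ofPred_eq ▸ hω) (not_le.2 (lt_of_le_of_lt ?_ (half_lt_self hε)))
  refine Real.iSup_le (fun t => Real.iSup_le (fun ht => ?_) (by positivity)) (by positivity)
  have hk : ⌊(n : ℝ) * t⌋₊ ≤ ⌊n * T⌋₊ := Nat.floor_mono (by gcongr; exact ht.2)
  have hbound := abs_sum_gridError_le hC hexp hφ hT hn (hpath ω hωs) hk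
  have hsum := hω₁' _ hk
  rw [← Finset.sum_sub_distrib, sum_Icc_one_eq_sum_range]
  simp only [gridError, gridMid, gridIncr] at hbound hω₂'
  simp only [Nat.cast_add, Nat.cast_one, add_sub_cancel_right] at hbound hω₂' ⊢
  linarith
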